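/- Under the dehomogenisation isomorphism φ_α of O_q(G(m,n))[M_α^{−1}] with K[x_{ij}][y_α^{±1};σ_α], every generating quantum minor [I] of O_q(G(m,n)) satisfies φ_α([I]) = [(α+m) − (M_α∖I_r) | I_c − (α+m−1)] · y_α, where I_r := I ∩ M_α, I_c := I ∖ I_r, the bracket on the right is a quantum minor of the quantum matrix algebra K[x_{ij}], and for a set N of integers and an integer i one writes i+N = {i+k : k∈N} and i−N = {i−k : k∈N}. -/

import Mathlib

open scoped BigOperators

namespace QG

variable (K : Type*) [Field K]

/-- The defining relations of the quantum matrix algebra `O_q(M_{m,n})`. -/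
inductive QMatRel (q : K) (m n : ℕ) :
    FreeAlgebra K (Fin m × Fin n) → FreeAlgebra K (Fin m × Fin n) → Prop
  | row : ∀ (i : Fin m) (j l : Fin n), j < l →
      QMatRel q m n (FreeAlgebra.ι K (i, j) * FreeAlgebra.ι K (i, l))
        (q • (FreeAlgebra.ι K (i, l) * FreeAlgebra.ι K (i, j)))
  | col : ∀ (i k : Fin m) (j : Fin n), i < k →
      QMatRel q m n (FreeAlgebra.ι K (i, j) * FreeAlgebra.ι K (k, j))
        (q • (FreeAlgebra.ι K (k, j) * FreeAlgebra.ι K (i, j)))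
  | comm : ∀ (i k : Fin m) (j l : Fin n), k < i → j < l →
      QMatRel q m n (FreeAlgebra.ι K (i, j) * FreeAlgebra.ι K (k, l))
        (FreeAlgebra.ι K (k, l) * FreeAlgebra.ι K (i, j))
  | qrel : ∀ (i k : Fin m) (j l : Fin n), i < k → j < l →
      QMatRel q m n
        (FreeAlgebra.ι K (i, j) * FreeAlgebra.ι K (k, l) -
          FreeAlgebra.ι K (k, l) * FreeAlgebra.ι K (i, j))
        ((q - q⁻¹) • (FreeAlgebra.ι K (i, l) * FreeAlgebra.ι K (k, j)))

/-- The quantum matrix algebra `O_q(M_{m,n})`. -/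
abbrev QMat (q : K) (m n : ℕ) := RingQuot (QMatRel K q m n)

/-- The generator `X_{ij}` of `O_q(M_{m,n})`. -/
noncomputable def X (q : K) {m n : ℕ} (i : Fin m) (j : Fin n) : QMat K q m n :=
  RingQuot.mkAlgHom K (QMatRel K q m n) (FreeAlgebra.ι K (i, j))

/-- The number of inversions (Coxeter length) of a permutation of `Fin t`. -/
def invCount {t : ℕ} (σ : Equiv.Perm (Fin t)) : ℕ :=
  ((Finset.univ : Finset (Fin t × Fin t)).filter fun p => p.1 < p.2 ∧ σ p.2 < σ p.1).card

/-- The quantum minor `Σ_σ (-q)^{ℓ(σ)} x_{σ(1)1} ⋯ x_{σ(t)t}` of a `t × t`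
matrix of elements of a `K`-algebra. -/
noncomputable def qMinor {A : Type*} [Ring A] [Algebra K A] (q : K) (t : ℕ)
    (x : Fin t → Fin t → A) : A :=
  ∑ σ : Equiv.Perm (Fin t), ((-q) ^ invCount σ) • (List.ofFn fun k => x (σ k) k).prod

/-- The maximal (`m × m`) quantum minor `[J]` of `O_q(M_{m,n})`, with column index set `J`
(columns taken in increasing order, rows `1,…,m`).  (Defined to be `0` if `J` does not
have exactly `m` elements.) -/
noncomputable def grMinor (q : K) (m : ℕ) {n : ℕ} (J : Finset (Fin n)) : QMat K q m n :=
  if h : J.card = m then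
    qMinor K q m (fun i k => X K q i (J.orderEmbOfFin h k)) else 0

/-- The set of maximal quantum minors of `O_q(M_{m,n})`. -/
def grGenSet (q : K) (m n : ℕ) : Set (QMat K q m n) :=
  {a | ∃ J : Finset (Fin n), a = grMinor K q m J}

/-- The quantum grassmannian `O_q(G(m,n))`: the subalgebra of `O_q(M_{m,n})`
generated by the maximal quantum minors. -/
noncomputable def qGrass (q : K) (m n : ℕ) : Subalgebra K (QMat K q m n) :=
  Algebra.adjoin K (grGenSet K q m n)

/-- The maximal quantum minor `[J]` viewed as an element of the quantum grassmannian. -/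
noncomputable def grE (q : K) (m : ℕ) {n : ℕ} (J : Finset (Fin n)) : ↥(qGrass K q m n) :=
  ⟨grMinor K q m J, Algebra.subset_adjoin ⟨J, rfl⟩⟩

/-- Reduction of a natural number modulo `n`, landing in `Fin n` (this encodes the
paper's convention that a column index is read modulo `n`; indices here are 0-based). -/
def fmod (n : ℕ) (hn : 0 < n) (k : ℕ) : Fin n := ⟨k % n, Nat.mod_lt k hn⟩

/-- The index set `{α, α+1, …, α+m-1}` (read modulo `n`) of a consecutive quantum minor
(0-based indices). -/
def consecSet {n : ℕ} (hn : 0 < n) (m : ℕ) (α : ℕ) : Finset (Fin n) :=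
  (Finset.range m).image fun k => fmod n hn (α + k)

end QG
namespace QG

variable (K : Type*) [Field K]

/-- Localisation of a `K`-algebra `A` at the powers of a normal element `u`:
an algebra `B` together with an injective map `A → B` inverting `u`, such that every
element of `B` has the form `a·u^{-k}`. -/
structure NormalLoc (A : Type*) [Ring A] [Algebra K A]
    (B : Type*) [Ring B] [Algebra K B] (u : A) where
  emb : A →ₐ[K] B
  inj : Function.Injective emb
  isUnit : IsUnit (emb u)
  surj : ∀ b : B, ∃ (a : A) (k : ℕ), b = emb a * ↑(isUnit.unit⁻¹ ^ k)

/-- The index set (0-based) of the quantum minor defining the dehomogenisation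
generator `x_{ij}` at the consecutive minor starting at `α`:
`M_α ∪ {~(α+m+j)} ∖ {~(α+(m-1-i))}`. -/
def JxSet {n : ℕ} (hn : 0 < n) (m : ℕ) (α : ℕ) (i : Fin m) (j : Fin (n - m)) :
    Finset (Fin n) :=
  insert (fmod n hn (α + m + j)) ((consecSet hn m α).erase (fmod n hn (α + (m - 1 - i))))

/-- The generator `x_{ij} = [M_α ∪ {~(α+m+j)} ∖ {~(α+(m-1-i))}]·M_α^{-1}` of the
dehomogenisation of the quantum grassmannian at the consecutive minor `M_α`. -/
noncomputable def xElt (q : K) (m n : ℕ) (hn : 0 < n) (α : ℕ)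
    {B : Type*} [Ring B] [Algebra K B]
    (L : NormalLoc K (↥(qGrass K q m n)) B (grE K q m (consecSet hn m α)))
    (i : Fin m) (j : Fin (n - m)) : B :=
  L.emb (grE K q m (JxSet hn m α i j)) * ↑(L.isUnit.unit⁻¹)

/-- `B` is a skew-Laurent extension `R[y^{±1};σ]` of the subalgebra `R`, where `σ` is
conjugation by the unit `y`:  `R` is stable under conjugation by `y` and `B` is free as a
left `R`-module with basis the (integer) powers of `y`. -/
def IsSkewLaurent {B : Type*} [Ring B] [Algebra K B] (R : Subalgebra K B) (y : Bˣ) : Prop :=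
  (∀ r ∈ R, (y : B) * r * ((y⁻¹ : Bˣ) : B) ∈ R) ∧
    ∀ b : B, ∃! f : ℤ →₀ ↥R, b = f.sum fun k r => (r : B) * ((y ^ k : Bˣ) : B)

/-- The quantum minor of a matrix of elements with row index set `R` and column index
set `C` (rows and columns taken in increasing order); `0` if the cardinalities differ. -/
noncomputable def finsetMinor {B : Type*} [Ring B] [Algebra K B] (q : K) {m c : ℕ}
    (x : Fin m → Fin c → B) (R : Finset (Fin m)) (C : Finset (Fin c)) : B :=
  if h : C.card = R.card then
    qMinor K q R.card (fun a b => x (R.orderEmbOfFin rfl a) (C.orderEmbOfFin h b))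
  else 0

/-- The row set `(α+m) − (M_α ∖ I_r)` (0-based) of the image of the maximal minor `[I]`
under the dehomogenisation at `M_α`. -/
def rowSetOf {n : ℕ} (hn : 0 < n) (m : ℕ) (α : ℕ) (I : Finset (Fin n)) : Finset (Fin m) :=
  (Finset.univ.filter fun k : Fin m => fmod n hn (α + k) ∉ I).image Fin.rev

/-- The column set `I_c − (α+m−1)` (0-based) of the image of the maximal minor `[I]`
under the dehomogenisation at `M_α`. -/
def colSetOf {n : ℕ} (hn : 0 < n) (m : ℕ) (α : ℕ) (I : Finset (Fin n)) :
    Finset (Fin (n - m)) :=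
  Finset.univ.filter fun d : Fin (n - m) => fmod n hn (α + m + d) ∈ I

/-- The last index (0-based, corresponding to the paper's index `n`). -/
def lastIdx (n : ℕ) (hn : 0 < n) : Fin n := ⟨n - 1, by omega⟩

/-- The 2-cocycle `c((s_1,…,s_n),(t_1,…,t_n)) = ∏_{j ≠ n} p^{s_n t_j}` on `ℤ^n`. -/
noncomputable def cmap {n : ℕ} (hn : 0 < n) (p : K) :
    (Fin n → ℤ) → (Fin n → ℤ) → K := fun s t =>
  ∏ j ∈ Finset.univ.filter (fun j : Fin n => j ≠ lastIdx n hn),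
    p ^ (s (lastIdx n hn) * t j)

/-- The content `ε(j+m) − ε(m+1−i)` of the dehomogenisation generator `x_{ij}`
(0-based: `ε(m+j) − ε(m-1-i)`). -/
def xContent (m n : ℕ) (i : Fin m) (j : Fin (n - m)) : Fin n → ℤ := fun l =>
  (if (l : ℕ) = m + j then 1 else 0) - (if (l : ℕ) = m - 1 - i then 1 else 0)

/-- The content `ε(1) + ⋯ + ε(m)` of `y` (equivalently, of a consecutive minor `M_1`). -/
def yContent (m n : ℕ) : Fin n → ℤ := fun l => if (l : ℕ) < m then 1 else 0

/-- The content `Σ_{i ∈ I} ε(i)` of a maximal quantum minor `[I]`. -/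
def contentOf {n : ℕ} (I : Finset (Fin n)) : Fin n → ℤ := fun l => if l ∈ I then 1 else 0

/-- A realization of the twist `T(A)` of a `ℤ^n`-graded `K`-algebra `A` by a
2-cocycle `c`: a `K`-algebra `T` together with a `K`-linear isomorphism `τ : A ≃ T`
(the twist map `a ↦ a'`) satisfying `a'b' = c(s,t)·(ab)'` on homogeneous elements. -/
structure CocycleTwist {n : ℕ} (A : Type*) [Ring A] [Algebra K A]
    (𝒜 : (Fin n → ℤ) → Submodule K A) (c : (Fin n → ℤ) → (Fin n → ℤ) → K)
    (T : Type*) [Ring T] [Algebra K T] where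
  τ : A ≃ₗ[K] T
  mul_tw : ∀ (s t : Fin n → ℤ) (a b : A), a ∈ 𝒜 s → b ∈ 𝒜 t →
    τ a * τ b = c s t • τ (a * b)

/-- The image of an index set under the cycle `(1 2 … n)` (0-based). -/
def shiftSet {n : ℕ} (hn : 0 < n) (I : Finset (Fin n)) : Finset (Fin n) :=
  I.image fun a : Fin n => fmod n hn (a.val + 1)

end QG
namespace QG
section aux
set_option linter.unusedSectionVars false
set_option linter.unusedSimpArgs false
open Finset

/-- Column operator. -/
noncomputable def T {K : Type*} [Field K] (q : K) {A : Type*} [Ring A] [Algebra K A]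
    {ρ κ : Type*} [LinearOrder ρ] (x : ρ → κ → A) (c : κ) (F : Finset ρ → A) :
    Finset ρ → A := fun R =>
  ∑ i ∈ R, ((-q) ^ (R.filter (· < i)).card) • (x i c * F (R.erase i))

/-- Row operator. -/
noncomputable def U {K : Type*} [Field K] (q : K) {A : Type*} [Ring A] [Algebra K A]
    {ρ κ : Type*} [LinearOrder κ] (x : ρ → κ → A) (i : ρ) (G : Finset κ → A) :
    Finset κ → A := fun S =>
  ∑ c ∈ S, ((-q) ^ (S.filter (c < ·)).card) • (G (S.erase c) * x i c)

/-- Expansion of a minor with a list of columns. -/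
noncomputable def DL {K : Type*} [Field K] (q : K) {A : Type*} [Ring A] [Algebra K A]
    {ρ κ : Type*} [LinearOrder ρ] (x : ρ → κ → A) (l : List κ) : Finset ρ → A :=
  l.foldr (T q x) (fun R => if R = ∅ then 1 else 0)

/-- Minor with column set `C`. -/
noncomputable def E {K : Type*} [Field K] (q : K) {A : Type*} [Ring A] [Algebra K A]
    {ρ κ : Type*} [LinearOrder ρ] [LinearOrder κ] (x : ρ → κ → A) (C : Finset κ) :
    Finset ρ → A :=
  DL q x (C.sort (· ≤ ·))

/-- The quantum matrix relations. -/
structure IsQ {K : Type*} [Field K] (q : K) {A : Type*} [Ring A] [Algebra K A]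
    {ρ κ : Type*} [LinearOrder ρ] [LinearOrder κ] (x : ρ → κ → A) : Prop where
  row : ∀ i j l, j < l → x i j * x i l = q • (x i l * x i j)
  col : ∀ i k j, i < k → x i j * x k j = q • (x k j * x i j)
  comm : ∀ i k j l, k < i → j < l → x i j * x k l = x k l * x i j
  qrel : ∀ i k j l, i < k → j < l →
    x i j * x k l - x k l * x i j = (q - q⁻¹) • (x i l * x k j)

variable {K : Type*} [Field K] {q : K} {A : Type*} [Ring A] [Algebra K A]
    {ρ κ : Type*} [LinearOrder ρ] [LinearOrder κ] {x : ρ → κ → A}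

lemma pair_sum {M : Type*} [AddCommGroup M] (R : Finset ρ) (f : ρ → ρ → M) :
    ∑ i ∈ R, ∑ j ∈ R.erase i, f i j =
      ∑ p ∈ (R ×ˢ R).filter (fun p => p.1 < p.2), (f p.1 p.2 + f p.2 p.1) := by
  rw [Finset.sum_sigma', Finset.sum_add_distrib]
  have h2 : ∑ p ∈ (R ×ˢ R).filter (fun p => p.1 < p.2), f p.2 p.1 =
      ∑ p ∈ (R ×ˢ R).filter (fun p => p.2 < p.1), f p.1 p.2 := by
    refine Finset.sum_nbij' Prod.swap Prod.swap ?_ ?_ ?_ ?_ ?_ <;> simp +contextual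
  rw [h2, ← Finset.sum_union]
  · refine Finset.sum_nbij' (fun p => (p.1, p.2)) (fun p => ⟨p.1, p.2⟩) ?_ ?_ ?_ ?_ ?_
    · rintro ⟨i, j⟩ h
      simp at h ⊢
      rcases lt_trichotomy i j with h' | h' | h' <;> simp_all
    · rintro ⟨i, j⟩ h
      simp at h ⊢
      rcases h with h | h
      · exact ⟨h.1.1, h.2.ne', h.1.2⟩
      · exact ⟨h.1.1, h.2.ne, h.1.2⟩
    · simp
    · simp
    · simp
  · rw [Finset.disjoint_left]
    rintro ⟨i, j⟩ h h'
    simp at h h'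
    exact absurd h.2 (not_lt.2 h'.2.le)

lemma pos_lt (R : Finset ρ) {i j : ρ} (hi : i ∈ R) (hij : i < j) :
    (R.filter (· < j)).card = ((R.erase i).filter (· < j)).card + 1 ∧
    ((R.erase j).filter (· < i)).card = (R.filter (· < i)).card := by
  constructor
  · rw [Finset.filter_erase, Finset.card_erase_of_mem (by simp [hi, hij])]
    have : 0 < (R.filter (· < j)).card := Finset.card_pos.2 ⟨i, by simp [hi, hij]⟩
    omega
  · rw [Finset.filter_erase, Finset.erase_eq_of_notMem]
    simp [hij.le]

lemma pos_gt (R : Finset ρ) {i j : ρ} (hj : j ∈ R) (hij : i < j) :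
    (R.filter (i < ·)).card = ((R.erase j).filter (i < ·)).card + 1 ∧
    ((R.erase i).filter (j < ·)).card = (R.filter (j < ·)).card := by
  constructor
  · rw [Finset.filter_erase, Finset.card_erase_of_mem (by simp [hj, hij])]
    have : 0 < (R.filter (i < ·)).card := Finset.card_pos.2 ⟨j, by simp [hj, hij]⟩
    omega
  · rw [Finset.filter_erase, Finset.erase_eq_of_notMem]
    simp [hij.le]

lemma TT_eq (c c' : κ) (F : Finset ρ → A) (R : Finset ρ) :
    T q x c' (T q x c F) R = ∑ p ∈ (R ×ˢ R).filter (fun p => p.1 < p.2),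
      ((-q) ^ ((R.filter (· < p.1)).card + ((R.erase p.1).filter (· < p.2)).card)) •
       ((x p.1 c' * x p.2 c - q • (x p.2 c' * x p.1 c)) * F ((R.erase p.1).erase p.2)) := by
  simp only [T, Finset.mul_sum, Finset.smul_sum]
  rw [pair_sum]
  refine Finset.sum_congr rfl ?_
  rintro ⟨i, j⟩ h
  simp only [Finset.mem_filter, Finset.mem_product] at h
  obtain ⟨⟨hi, hj⟩, hij⟩ := h
  obtain ⟨h1, h2⟩ := pos_lt R hi hij
  simp only [h1, h2]
  rw [Finset.erase_right_comm (a := j) (b := i)]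
  simp only [mul_smul_comm, smul_smul, sub_mul, smul_sub, smul_mul_assoc, mul_assoc]
  rw [sub_eq_add_neg, ← neg_smul]
  congr 2
  · rw [← pow_add]
  · ring

lemma UU_eq (i k : ρ) (G : Finset κ → A) (S : Finset κ) :
    U q x k (U q x i G) S = ∑ p ∈ (S ×ˢ S).filter (fun p => p.1 < p.2),
      ((-q) ^ ((S.filter (p.2 < ·)).card + ((S.erase p.2).filter (p.1 < ·)).card)) •
       (G ((S.erase p.1).erase p.2) * (x i p.1 * x k p.2 - q • (x i p.2 * x k p.1))) := by
  simp only [U, Finset.sum_mul, Finset.smul_sum]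
  rw [pair_sum]
  refine Finset.sum_congr rfl ?_
  rintro ⟨a, b⟩ h
  simp only [Finset.mem_filter, Finset.mem_product] at h
  obtain ⟨⟨ha, hb⟩, hij⟩ := h
  obtain ⟨h1, h2⟩ := pos_gt S hb hij
  simp only [h1, h2]
  rw [Finset.erase_right_comm (a := b) (b := a)]
  simp only [mul_smul_comm, smul_smul, mul_sub, smul_sub, smul_mul_assoc, mul_assoc]
  rw [sub_eq_add_neg, ← neg_smul, add_comm]
  congr 2
  · rw [← pow_add]
  · ring

lemma IsQ.two (hq : q ≠ 0) (hx : IsQ q x) {i k : ρ} {j l : κ} (hik : i < k) (hjl : j < l) :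
    x i l * x k j - q • (x k l * x i j) = (-q) • (x i j * x k l - q • (x k j * x i l)) := by
  have h1 := hx.comm k i j l hik hjl
  have h2 := hx.qrel i k j l hik hjl
  have h3 : x k l * x i j = x i j * x k l - (q - q⁻¹) • (x i l * x k j) := by
    rw [← h2]; abel
  rw [h3, h1]
  have : q * (q - q⁻¹) = q * q - 1 := by field_simp
  simp only [smul_sub, smul_smul, this]
  simp only [sub_smul, neg_smul, one_smul, neg_mul]
  abel

lemma T_sq (hx : IsQ q x) (c : κ) (F : Finset ρ → A) : T q x c (T q x c F) = 0 := by
  funext R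
  rw [TT_eq]
  refine Finset.sum_eq_zero ?_
  rintro ⟨i, j⟩ h
  simp only [Finset.mem_filter, Finset.mem_product] at h
  simp [hx.col i j c h.2]

lemma T_swap (hq : q ≠ 0) (hx : IsQ q x) {c c' : κ} (hc : c < c') (F : Finset ρ → A) :
    T q x c' (T q x c F) = (-q) • T q x c (T q x c' F) := by
  funext R
  rw [Pi.smul_apply, TT_eq, TT_eq, Finset.smul_sum]
  refine Finset.sum_congr rfl ?_
  rintro ⟨i, j⟩ h
  simp only [Finset.mem_filter, Finset.mem_product] at h
  simp only
  rw [hx.two hq h.2 hc, smul_mul_assoc, smul_comm]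

lemma U_sq (hx : IsQ q x) (i : ρ) (G : Finset κ → A) : U q x i (U q x i G) = 0 := by
  funext S
  rw [UU_eq]
  refine Finset.sum_eq_zero ?_
  rintro ⟨a, b⟩ h
  simp only [Finset.mem_filter, Finset.mem_product] at h
  simp [hx.row i a b h.2]

lemma U_swap (hq : q ≠ 0) (hx : IsQ q x) {i k : ρ} (hc : i < k) (G : Finset κ → A) :
    U q x i (U q x k G) = (-q) • U q x k (U q x i G) := by
  funext S
  rw [Pi.smul_apply, UU_eq, UU_eq, Finset.smul_sum]
  refine Finset.sum_congr rfl ?_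
  rintro ⟨a, b⟩ h
  simp only [Finset.mem_filter, Finset.mem_product] at h
  simp only
  have h1 := hx.comm k i a b hc h.2
  have h2 := hx.two hq hc h.2
  have h3 : x k a * x i b - q • (x k b * x i a)
      = (-q) • (x i a * x k b - q • (x i b * x k a)) := by
    rw [h1, h2, h1]
  rw [h3, mul_smul_comm, smul_comm]

lemma T_smul (c : κ) (k : K) (F : Finset ρ → A) : T q x c (k • F) = k • T q x c F := by
  funext R
  simp only [T, Pi.smul_apply, Finset.smul_sum, mul_smul_comm]
  exact Finset.sum_congr rfl fun i _ => smul_comm _ _ _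

lemma T_zero (c : κ) : T q x c (0 : Finset ρ → A) = 0 := by
  funext R; simp [T]

lemma U_zero (c : ρ) : U q x c (0 : Finset κ → A) = 0 := by
  funext R; simp [U]

lemma E_empty (R : Finset ρ) : E q x ∅ R = if R = ∅ then 1 else 0 := by
  simp [E, DL]

lemma E_insert {a : κ} {s : Finset κ} (h : ∀ b ∈ s, a < b) :
    E q x (insert a s) = T q x a (E q x s) := by
  have : a ∉ s := fun h' => lt_irrefl _ (h a h')
  unfold E DL
  rw [Finset.sort_insert _ (fun b hb => (h b hb).le) this, List.foldr_cons]

lemma T_E (hq : q ≠ 0) (hx : IsQ q x) (C : Finset κ) : ∀ r : κ,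
    T q x r (E q x C) = if r ∈ C then 0 else
      ((-q) ^ (C.filter (· < r)).card) • E q x (insert r C) := by
  induction C using Finset.induction_on_min with
  | empty => intro r; simp [← E_insert (q := q) (x := x) (a := r) (s := ∅)]
  | insert a s h ih =>
    intro r
    rw [E_insert h]
    have ha : a ∉ s := fun h' => lt_irrefl _ (h a h')
    rcases lt_trichotomy r a with h1 | h1 | h1
    · have hr : ∀ b ∈ insert a s, r < b := by
        intro b hb
        rcases Finset.mem_insert.1 hb with rfl | hb
        · exact h1
        · exact h1.trans (h b hb)
      rw [if_neg (fun h' => lt_irrefl _ (hr r h')), E_insert hr, E_insert h,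
        Finset.filter_false_of_mem (fun b hb => (hr b hb).not_gt)]
      simp
    · subst h1
      simp [T_sq hx]
    · rw [T_swap hq hx h1, ih r]
      by_cases hr : r ∈ s
      · simp [hr, T_zero]
      · rw [if_neg hr, if_neg (by simp [hr, h1.ne']), T_smul, Finset.insert_comm,
          E_insert (a := a) (s := insert r s), Finset.filter_insert, if_pos h1,
          Finset.card_insert_of_notMem (by simp [ha]), smul_smul]
        · congr 1; ring
        · intro b hb
          rcases Finset.mem_insert.1 hb with rfl | hb
          · exact h1
          · exact h b hb

lemma DL_zero : ∀ (l : List κ) (R : Finset ρ), l.length ≠ R.card → DL q x l R = 0 := by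
  intro l
  induction l with
  | nil =>
    intro R h
    have : R ≠ ∅ := by rintro rfl; simp at h
    simp [DL, this]
  | cons a l ih =>
    intro R h
    change T q x a (DL q x l) R = 0
    refine Finset.sum_eq_zero fun i hi => ?_
    rw [ih, mul_zero, smul_zero]
    rw [Finset.card_erase_of_mem hi]
    have := Finset.card_pos.2 ⟨i, hi⟩
    simp at h
    omega

lemma E_zero (C : Finset κ) (R : Finset ρ) (h : C.card ≠ R.card) : E q x C R = 0 :=
  DL_zero _ _ (by simpa using h)

lemma E_comm (hx : IsQ q x) (N : ρ) (a : κ) (C : Finset κ) : (∀ c ∈ C, a < c) →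
    ∀ R : Finset ρ, (∀ i ∈ R, i < N) → x N a * E q x C R = E q x C R * x N a := by
  induction C using Finset.induction_on_min with
  | empty => intro _ R _; rw [E_empty]; split_ifs <;> simp
  | insert b s h ih =>
    intro hC R hR
    rw [E_insert h]
    simp only [T, Finset.mul_sum, Finset.sum_mul]
    refine Finset.sum_congr rfl fun i hi => ?_
    rw [mul_smul_comm, smul_mul_assoc, ← mul_assoc,
      hx.comm N i a b (hR i hi) (hC b (by simp)), mul_assoc, mul_assoc,
      ih (fun c hc => hC c (by simp [hc])) _ (fun j hj => hR j (Finset.mem_of_mem_erase hj))]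

lemma E_row (hx : IsQ q x) (C : Finset κ) : ∀ (R : Finset ρ) (N : ρ), (∀ i ∈ R, i < N) →
    E q x C (insert N R) = U q x N (fun D => E q x D R) C := by
  induction C using Finset.induction_on_min with
  | empty => intro R N _; simp [E_empty, U]
  | insert a s h ih =>
    intro R N hR
    have hN : N ∉ R := fun h' => lt_irrefl _ (hR N h')
    have ha : a ∉ s := fun h' => lt_irrefl _ (h a h')
    rw [E_insert h]
    simp only [T, U]
    rw [Finset.sum_insert hN, Finset.sum_insert ha]
    congr 1
    · rw [Finset.erase_insert hN, Finset.erase_insert ha, E_comm hx N a s h R hR]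
      by_cases hc : s.card = R.card
      · congr 2
        rw [Finset.filter_insert, if_neg (lt_irrefl _), Finset.filter_true_of_mem hR,
          Finset.filter_insert, if_neg (lt_irrefl _), Finset.filter_true_of_mem h, hc]
      · rw [E_zero _ _ hc]; simp
    · have h1 : ∀ i ∈ R, ((-q) ^ ((insert N R).filter (· < i)).card) •
          (x i a * E q x s ((insert N R).erase i)) =
          ∑ c ∈ s, ((-q) ^ (R.filter (· < i)).card) • (x i a *
            (((-q) ^ (s.filter (c < ·)).card) • (E q x (s.erase c) (R.erase i) * x N c))) := by
        intro i hi
        have hne : N ≠ i := (hR i hi).ne'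
        rw [Finset.erase_insert_of_ne hne, ih (R.erase i) N
          (fun j hj => hR j (Finset.mem_of_mem_erase hj)), Finset.filter_insert,
          if_neg (hR i hi).not_gt]
        simp only [U, Finset.mul_sum, Finset.smul_sum]
      rw [Finset.sum_congr rfl h1, Finset.sum_comm]
      refine Finset.sum_congr rfl fun c hc => ?_
      have hac : a ≠ c := (h c hc).ne
      rw [Finset.erase_insert_of_ne hac, E_insert (fun b hb => h b (Finset.mem_of_mem_erase hb)),
        Finset.filter_insert, if_neg (h c hc).not_gt]
      simp only [T, Finset.sum_mul, Finset.smul_sum]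
      refine Finset.sum_congr rfl fun i hi => ?_
      simp only [mul_smul_comm, smul_mul_assoc, mul_assoc]
      rw [smul_comm]

lemma U_E_zero (hq : q ≠ 0) (hx : IsQ q x) (R : Finset ρ) : ∀ k ∈ R,
    U q x k (fun D => E q x D R) = 0 := by
  induction R using Finset.induction_on_max with
  | empty => simp
  | insert N R h ih =>
    intro k hk
    have h1 : (fun D => E q x D (insert N R)) = U q x N (fun D => E q x D R) := by
      funext D; exact E_row hx D R N h
    rw [h1]
    rcases Finset.mem_insert.1 hk with rfl | hk
    · exact U_sq hx _ _
    · rw [U_swap hq hx (h k hk), ih k hk, U_zero, smul_zero]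

/-- Quantum Pluecker relation. -/
lemma pluecker (hq : q ≠ 0) (hx : IsQ q x) (R : Finset ρ) (S C : Finset κ) :
    ∑ r ∈ S \ C, ((-q) ^ ((S.filter (r < ·)).card + (C.filter (· < r)).card)) •
      (E q x (S.erase r) R * E q x (insert r C) R) = 0 := by
  have h0 : ∑ k ∈ R, ((-q) ^ (R.filter (· < k)).card) •
      (U q x k (fun D => E q x D R) S * E q x C (R.erase k)) = 0 := by
    refine Finset.sum_eq_zero fun k hk => ?_
    rw [U_E_zero hq hx R k hk]; simp
  have h1 : ∑ r ∈ S, ((-q) ^ (S.filter (r < ·)).card) •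
      (E q x (S.erase r) R * T q x r (E q x C) R) = 0 := by
    rw [← h0]
    simp only [T, U, Finset.sum_mul, Finset.mul_sum, Finset.smul_sum]
    rw [Finset.sum_comm]
    refine Finset.sum_congr rfl fun k hk => Finset.sum_congr rfl fun c hc => ?_
    simp only [mul_smul_comm, smul_mul_assoc, mul_assoc]
    rw [smul_comm]
  rw [← h1, ← Finset.sum_subset (Finset.sdiff_subset (s := S) (t := C))]
  · refine Finset.sum_congr rfl fun r hr => ?_
    rw [Finset.mem_sdiff] at hr
    rw [T_E hq hx, if_neg hr.2, Pi.smul_apply, mul_smul_comm, smul_smul, pow_add]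
  · intro r hr hr'
    have : r ∈ C := by simpa [hr] using hr'
    rw [T_E hq hx, if_pos this]; simp

end aux
end QG
namespace QG
section aux2
set_option linter.unusedSectionVars false
open Finset

/-- The permutation with first value `i` and the rest given by `τ`. -/
noncomputable def consPerm {t : ℕ} (p : Fin (t + 1) × Equiv.Perm (Fin t)) :
    Equiv.Perm (Fin (t + 1)) :=
  Equiv.ofBijective (Fin.cons p.1 (fun k => p.1.succAbove (p.2 k)) : Fin (t + 1) → Fin (t + 1))
    (Finite.injective_iff_bijective.1 (by
      rw [Fin.cons_injective_iff]
      refine ⟨?_, fun a b h => p.2.injective (Fin.succAbove_right_injective h)⟩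
      rintro ⟨k, hk⟩
      exact Fin.succAbove_ne _ _ hk))

lemma consPerm_zero {t : ℕ} (p : Fin (t + 1) × Equiv.Perm (Fin t)) : consPerm p 0 = p.1 := rfl

lemma consPerm_succ {t : ℕ} (p : Fin (t + 1) × Equiv.Perm (Fin t)) (k : Fin t) :
    consPerm p k.succ = p.1.succAbove (p.2 k) := rfl

lemma consPerm_bij (t : ℕ) : Function.Bijective (consPerm (t := t)) := by
  rw [Fintype.bijective_iff_injective_and_card]
  constructor
  · rintro ⟨i, τ⟩ ⟨j, υ⟩ h
    have h0 : i = j := by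
      exact congrArg (fun σ : Equiv.Perm (Fin (t + 1)) => σ 0) h
    subst h0
    congr 1
    ext1 k
    have := congrArg (fun σ : Equiv.Perm (Fin (t + 1)) => σ k.succ) h
    simp only [consPerm_succ] at this
    exact Fin.succAbove_right_injective this
  · simp [Fintype.card_perm, Nat.factorial_succ]

lemma invCount_eq {t : ℕ} (σ : Equiv.Perm (Fin t)) :
    invCount σ = ∑ a, ∑ b, if a < b ∧ σ b < σ a then 1 else 0 := by
  rw [invCount, Finset.card_filter, ← Finset.univ_product_univ, Finset.sum_product]

lemma invCount_consPerm {t : ℕ} (i : Fin (t + 1)) (τ : Equiv.Perm (Fin t)) :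
    invCount (consPerm (i, τ)) = i + invCount τ := by
  rw [invCount_eq, invCount_eq, Fin.sum_univ_succ]
  simp only [Fin.sum_univ_succ (n := t)]
  simp only [consPerm_zero, consPerm_succ, Fin.succ_lt_succ_iff, Fin.succAbove_lt_succAbove_iff,
    lt_irrefl, Fin.not_lt_zero, false_and, if_false, zero_add, Fin.succ_pos, true_and]
  congr 1
  rw [Equiv.sum_comp τ (fun a => if i.succAbove a < i then 1 else 0)]
  have h : ∀ a : Fin t, (i.succAbove a < i) ↔ (a : ℕ) < i := by
    intro a
    rw [Fin.succAbove_lt_iff_castSucc_lt]; rfl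
  simp only [h]
  rw [← Finset.card_filter]
  rw [Fin.card_filter_val_lt]
  omega

lemma qMinor_succ {K : Type*} [Field K] {A : Type*} [Ring A] [Algebra K A] (q : K) (t : ℕ)
    (x : Fin (t + 1) → Fin (t + 1) → A) :
    qMinor K q (t + 1) x = ∑ i : Fin (t + 1), ((-q) ^ (i : ℕ)) •
      (x i 0 * qMinor K q t (fun a b => x (i.succAbove a) b.succ)) := by
  rw [qMinor, ← (consPerm_bij t).sum_comp, Fintype.sum_prod_type]
  refine Finset.sum_congr rfl fun i _ => ?_
  rw [qMinor, Finset.mul_sum, Finset.smul_sum]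
  refine Finset.sum_congr rfl fun τ _ => ?_
  rw [invCount_consPerm, List.ofFn_succ, List.prod_cons, consPerm_zero, mul_smul_comm, smul_smul,
    pow_add]
  simp only [consPerm_succ]

variable {K : Type*} [Field K] {q : K} {A : Type*} [Ring A] [Algebra K A]
    {ρ κ : Type*} [LinearOrder ρ] [LinearOrder κ] {x : ρ → κ → A}

lemma DL_cons (a : κ) (l : List κ) : DL q x (a :: l) = T q x a (DL q x l) := rfl

lemma DL_eq_qMinor (t : ℕ) : ∀ (f : Fin t → ρ) (_ : StrictMono f) (g : Fin t → κ),
    DL q x (List.ofFn g) (univ.image f) = qMinor K q t (fun a b => x (f a) (g b)) := by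
  induction t with
  | zero =>
    intro f hf g
    simp [DL, qMinor, invCount]
  | succ t ih =>
    intro f hf g
    rw [qMinor_succ, List.ofFn_succ]
    rw [DL_cons, T, Finset.sum_image (fun a _ b _ h => hf.injective h)]
    refine Finset.sum_congr rfl fun i _ => ?_
    rw [← ih (fun a => f (i.succAbove a)) (hf.comp (Fin.strictMono_succAbove i))
      (fun b => g b.succ)]
    congr 3
    · rw [Finset.filter_image, Finset.card_image_of_injective _ hf.injective]
      simp only [hf.lt_iff_lt]
      rw [Finset.filter_gt_eq_Iio, Fin.card_Iio]
    · ext r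
      simp only [mem_erase, mem_image, mem_univ, true_and]
      constructor
      · rintro ⟨h1, a, rfl⟩
        have : a ≠ i := fun h => h1 (by rw [h])
        obtain ⟨b, rfl⟩ := Fin.exists_succAbove_eq this
        exact ⟨b, rfl⟩
      · rintro ⟨b, rfl⟩
        exact ⟨fun h => Fin.succAbove_ne i b (hf.injective h), _, rfl⟩

lemma ofFn_orderEmb {t : ℕ} (C : Finset κ) (h : C.card = t) :
    List.ofFn (C.orderEmbOfFin h) = C.sort (· ≤ ·) := by
  apply List.ext_getElem
  · simp [h]
  · intro i h1 h2
    simp [Finset.orderEmbOfFin_apply]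

lemma finsetMinor_eq {m c : ℕ} (x : Fin m → Fin c → A) (R : Finset (Fin m)) (C : Finset (Fin c)) :
    finsetMinor K q x R C = E q x C R := by
  unfold finsetMinor
  split_ifs with h
  · rw [E, ← ofFn_orderEmb C h]
    rw [← DL_eq_qMinor _ _ (R.orderEmbOfFin rfl).strictMono, Finset.image_orderEmbOfFin_univ]
  · rw [E_zero _ _ h]

lemma grMinor_eq {m n : ℕ} (J : Finset (Fin n)) :
    grMinor K q m J = E q (X K q (m := m) (n := n)) J univ := by
  unfold grMinor
  split_ifs with h
  · rw [E, ← ofFn_orderEmb J h]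
    have := DL_eq_qMinor (q := q) (x := X K q (m := m) (n := n)) m id strictMono_id
      (J.orderEmbOfFin h)
    rw [Finset.image_id] at this
    rw [this]; rfl
  · rw [E_zero _ _ (by simpa using h)]

lemma X_isQ (m n : ℕ) : IsQ q (X K q (m := m) (n := n)) where
  row i j l h := by
    have := RingQuot.mkAlgHom_rel K (QMatRel.row (K := K) (q := q) i j l h)
    simpa only [map_mul, map_smul, X] using this
  col i k j h := by
    have := RingQuot.mkAlgHom_rel K (QMatRel.col (K := K) (q := q) i k j h)
    simpa only [map_mul, map_smul, X] using this
  comm i k j l h h' := by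
    have := RingQuot.mkAlgHom_rel K (QMatRel.comm (K := K) (q := q) i k j l h h')
    simpa only [map_mul, map_smul, X] using this
  qrel i k j l h h' := by
    have := RingQuot.mkAlgHom_rel K (QMatRel.qrel (K := K) (q := q) i k j l h h')
    simpa only [map_mul, map_smul, map_sub, X] using this

lemma gr_pluecker (hq : q ≠ 0) {m n : ℕ} {B : Type*} [Ring B] [Algebra K B]
    (φ : ↥(qGrass K q m n) →ₐ[K] B) (S C : Finset (Fin n)) :
    ∑ r ∈ S \ C, ((-q) ^ ((S.filter (r < ·)).card + (C.filter (· < r)).card)) •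
      (φ (grE K q m (S.erase r)) * φ (grE K q m (insert r C))) = 0 := by
  have h : ∑ r ∈ S \ C, ((-q) ^ ((S.filter (r < ·)).card + (C.filter (· < r)).card)) •
      (grE K q m (S.erase r) * grE K q m (insert r C)) = 0 := by
    apply Subtype.ext
    have := pluecker hq (X_isQ (K := K) (q := q) m n) univ S C
    simpa only [AddSubmonoidClass.coe_finsetSum, Subalgebra.coe_smul, Subalgebra.coe_mul, grE,
      grMinor_eq, ZeroMemClass.coe_zero] using this
  have := congrArg φ h
  simpa only [map_sum, map_smul, map_mul, map_zero] using this

end aux2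
end QG
namespace QG
section aux3
set_option linter.unusedSectionVars false
open Finset

lemma sdiff_aux {κ : Type*} [DecidableEq κ] {M I : Finset κ} {r c : κ} (hr : r ∈ M) :
    insert r (I.erase c) \ M = (I \ M).erase c := by
  ext y
  simp only [mem_sdiff, mem_insert, mem_erase]
  constructor
  · rintro ⟨rfl | h, h'⟩
    · exact absurd hr h'
    · exact ⟨h.1, h.2, h'⟩
  · rintro ⟨h1, h2, h3⟩
    exact ⟨Or.inr ⟨h1, h2⟩, h3⟩

/-- The exponent in the exchange relation. -/
def cnt {κ : Type*} [LinearOrder κ] (M I : Finset κ) (c r : κ) : ℕ :=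
  ((insert c M).filter (r < ·)).card + ((I.erase c).filter (· < r)).card

lemma cnt_eq {κ : Type*} [LinearOrder κ] [Fintype κ] {M I : Finset κ} {c r : κ}
    (hcM : c ∉ M) (hcI : c ∈ I) (hrM : r ∈ M) (hrI : r ∉ I) :
    (cnt M I c r : ℤ) - cnt M I c c = (if r < c then 1 else -1) +
      ∑ y ∈ (M \ I).erase r, ((if r < y then 1 else 0) - (if c < y then 1 else 0)) +
      ∑ y ∈ (I \ M).erase c, ((if y < r then 1 else 0) - (if y < c then 1 else 0)) := by
  have hrc : r ≠ c := by rintro rfl; exact hcM hrM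
  have e1 : ((if r < c then 1 else -1 : ℤ)) =
      ∑ y : κ, ((if y = c then (if r < c then 1 else 0) else 0)
        - (if y = r then (if c < r then 1 else 0) else 0)) := by
    rw [Finset.sum_sub_distrib, Finset.sum_ite_eq', Finset.sum_ite_eq']
    rcases lt_or_gt_of_ne hrc with h | h <;> simp [h, h.not_gt]
  have e2 : ∀ (P : Finset κ) (f : κ → ℤ), ∑ y ∈ P, f y = ∑ y : κ, if y ∈ P then f y else 0 := by
    intro P f; simp
  unfold cnt
  push_cast
  simp only [Finset.card_filter]
  push_cast
  rw [e1]
  rw [e2 (insert c M), e2 (insert c M), e2 (I.erase c), e2 (I.erase c), e2 ((M \ I).erase r),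
    e2 ((I \ M).erase c)]
  rw [← Finset.sum_add_distrib, ← Finset.sum_add_distrib, ← Finset.sum_add_distrib,
    ← Finset.sum_add_distrib, ← Finset.sum_sub_distrib]
  refine Finset.sum_congr rfl fun y _ => ?_
  simp only [mem_insert, mem_erase, mem_sdiff]
  by_cases h1 : y = c
  · subst h1
    simp [hcM, hcI, hrc.symm]
  by_cases h2 : y = r
  · subst h2
    simp [hrM, hrI, h1]
  by_cases h3 : y ∈ M <;> by_cases h4 : y ∈ I <;> simp [h1, h2, h3, h4]
  rcases lt_or_gt_of_ne h1 with h | h <;> rcases lt_or_gt_of_ne h2 with h' | h' <;>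
    simp [h, h', h.not_gt, h'.not_gt]

variable {K : Type*} [Field K] {q : K} {B : Type*} [Ring B] [Algebra K B] {κ : Type*}
  [LinearOrder κ] [Fintype κ]

/-- The family satisfies quantum Pluecker relations. -/
def IsPl (q : K) (e : Finset κ → B) : Prop := ∀ S C : Finset κ,
    ∑ r ∈ S \ C, ((-q) ^ ((S.filter (r < ·)).card + (C.filter (· < r)).card)) •
      (e (S.erase r) * e (insert r C)) = 0

variable {e : Finset κ → B}

lemma exch (hq : q ≠ 0) (he : IsPl q e) {M I : Finset κ} {c : κ} (hcM : c ∉ M) (hcI : c ∈ I) :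
    e M * e I = ∑ r ∈ M \ I, (-((-q) ^ ((cnt M I c r : ℤ) - cnt M I c c))) •
      (e (insert c (M.erase r)) * e (insert r (I.erase c))) := by
  have hq' : -q ≠ 0 := neg_ne_zero.2 hq
  have h := he (insert c M) (I.erase c)
  have hS : insert c M \ I.erase c = insert c (M \ I) := by
    ext y
    simp only [mem_sdiff, mem_insert, mem_erase]
    by_cases hy : y = c <;> simp [hy]
  rw [hS, Finset.sum_insert (by simp [hcM]), Finset.erase_insert hcM, Finset.insert_erase hcI] at h
  have h2 : ((-q) ^ (cnt M I c c)) • (e M * e I) = - ∑ r ∈ M \ I, ((-q) ^ (cnt M I c r)) •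
      (e (insert c (M.erase r)) * e (insert r (I.erase c))) := by
    rw [← add_eq_zero_iff_eq_neg, ← h]
    congr 1
    refine Finset.sum_congr rfl fun r hr => ?_
    have : c ≠ r := by rintro rfl; simp [hcM] at hr
    rw [Finset.erase_insert_of_ne this]; rfl
  have h3 : e M * e I = ((-q) ^ (cnt M I c c))⁻¹ • (((-q) ^ (cnt M I c c)) • (e M * e I)) := by
    rw [smul_smul, inv_mul_cancel₀ (pow_ne_zero _ hq'), one_smul]
  rw [h3, h2, ← Finset.sum_neg_distrib, Finset.smul_sum]
  refine Finset.sum_congr rfl fun r hr => ?_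
  rw [← neg_smul, smul_smul]
  congr 1
  rw [zpow_sub₀ hq', zpow_natCast, zpow_natCast]
  ring

/-- sign -/
def sg (r c : κ) : ℤ := if r < c then 1 else -1

lemma neg_zpow_sg (r c : κ) : -((-q) ^ (sg r c)) = q ^ (sg r c) := by
  unfold sg
  split_ifs
  · simp
  · simp [inv_neg]

lemma qc_one (hq : q ≠ 0) (he : IsPl q e) {M : Finset κ} {r c : κ} (hr : r ∈ M) (hc : c ∉ M) :
    e M * e (insert c (M.erase r)) = (q ^ sg r c) • (e (insert c (M.erase r)) * e M) := by
  have hrc : r ≠ c := by rintro rfl; exact hc hr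
  rw [exch hq he hc (Finset.mem_insert_self _ _)]
  have h1 : M \ insert c (M.erase r) = {r} := by
    ext y
    simp only [mem_sdiff, mem_insert, mem_erase, mem_singleton]
    grind
  have h2 : insert c (M.erase r) \ M = {c} := by
    ext y
    simp only [mem_sdiff, mem_insert, mem_erase, mem_singleton]
    grind
  have h3 : c ∉ M.erase r := by simp [hc]
  rw [h1, Finset.sum_singleton, Finset.erase_insert h3, Finset.insert_erase hr,
    cnt_eq hc (Finset.mem_insert_self _ _) hr (by simp [hrc]), h1, h2, ← neg_zpow_sg]
  simp [sg]

/-- weight function adapted to `M` -/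
def IsWt (M : Finset κ) (h : κ → ℤ) : Prop := ∀ r ∈ M, ∀ c ∉ M, h c - h r = sg r c

lemma qc (hq : q ≠ 0) (he : IsPl q e) {M : Finset κ} (hM : IsUnit (e M)) {h : κ → ℤ}
    (hh : IsWt M h) (t : ℕ) : ∀ I : Finset κ, I.card = M.card → (I \ M).card = t →
    e M * e I = (q ^ (∑ y ∈ I, h y - ∑ y ∈ M, h y)) • (e I * e M) := by
  induction t with
  | zero =>
    intro I hI h0
    have : I = M := Finset.eq_of_subset_of_card_le
      (Finset.sdiff_eq_empty_iff_subset.1 (Finset.card_eq_zero.1 h0)) hI.ge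
    subst this; simp
  | succ t ih =>
    intro I hI hIt
    obtain ⟨c, hc⟩ : (I \ M).Nonempty := Finset.card_pos.1 (by omega)
    rw [Finset.mem_sdiff] at hc
    obtain ⟨hcI, hcM⟩ := hc
    apply hM.mul_left_cancel
    rw [mul_smul_comm, ← mul_assoc (e M) (e I) (e M), exch hq he hcM hcI, Finset.mul_sum,
      Finset.sum_mul, Finset.smul_sum]
    refine Finset.sum_congr rfl fun r hr => ?_
    rw [Finset.mem_sdiff] at hr
    obtain ⟨hrM, hrI⟩ := hr
    have hrc : r ∉ I.erase c := by simp [hrI]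
    have hcard : (insert r (I.erase c)).card = M.card := by
      rw [Finset.card_insert_of_notMem hrc, Finset.card_erase_of_mem hcI, ← hI]
      have := Finset.card_pos.2 ⟨c, hcI⟩
      omega
    have hs : insert r (I.erase c) \ M = (I \ M).erase c := sdiff_aux hrM
    have h1 := ih (insert r (I.erase c)) hcard (by
      rw [hs, Finset.card_erase_of_mem (by simp [hcI, hcM])]; omega)
    have h2 := qc_one hq he hrM hcM
    rw [mul_smul_comm, smul_mul_assoc, smul_comm (q ^ _) (-_)]
    congr 1
    rw [← mul_assoc, h2, smul_mul_assoc, mul_assoc, h1, mul_smul_comm, smul_smul, mul_assoc,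
      ← zpow_add₀ hq]
    congr 2
    rw [Finset.sum_insert hrc, ← hh r hrM c hcM, ← Finset.add_sum_erase I h hcI]
    ring

lemma step (hq : q ≠ 0) (he : IsPl q e) {M : Finset κ} (hM : IsUnit (e M)) {h : κ → ℤ}
    (hh : IsWt M h) {I : Finset κ} (hI : I.card = M.card) {c : κ} (hcM : c ∉ M) (hcI : c ∈ I)
    (pos : κ → ℕ) (hpos : ∀ r ∈ M \ I, (cnt M I c r : ℤ) - cnt M I c c = pos r + sg r c) :
    e I = ∑ r ∈ M \ I, ((-q) ^ pos r) • (e (insert c (M.erase r)) * ↑(hM.unit⁻¹) *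
      e (insert r (I.erase c))) := by
  have hq' : -q ≠ 0 := neg_ne_zero.2 hq
  apply hM.mul_right_cancel
  have h0 := qc hq he hM hh _ I hI rfl
  have h1 : e I * e M = (q ^ (∑ y ∈ M, h y - ∑ y ∈ I, h y)) • (e M * e I) := by
    rw [h0, smul_smul, ← zpow_add₀ hq]; simp
  rw [h1, exch hq he hcM hcI, Finset.smul_sum, Finset.sum_mul]
  refine Finset.sum_congr rfl fun r hr => ?_
  have hp := hpos r hr
  rw [Finset.mem_sdiff] at hr
  obtain ⟨hrM, hrI⟩ := hr
  have hrc : r ∉ I.erase c := by simp [hrI]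
  have hcard : (insert r (I.erase c)).card = M.card := by
    rw [Finset.card_insert_of_notMem hrc, Finset.card_erase_of_mem hcI, ← hI]
    have := Finset.card_pos.2 ⟨c, hcI⟩
    omega
  have h2 := qc hq he hM hh _ (insert r (I.erase c)) hcard rfl
  have h3 : ↑(hM.unit⁻¹) * e (insert r (I.erase c)) * e M =
      (q ^ (∑ y ∈ M, h y - ∑ y ∈ insert r (I.erase c), h y)) • e (insert r (I.erase c)) := by
    have : e (insert r (I.erase c)) * e M =
      (q ^ (∑ y ∈ M, h y - ∑ y ∈ insert r (I.erase c), h y)) •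
        (e M * e (insert r (I.erase c))) := by
      rw [h2, smul_smul, ← zpow_add₀ hq]; simp
    rw [mul_assoc, this, mul_smul_comm, ← mul_assoc, IsUnit.val_inv_mul, one_mul]
  rw [smul_mul_assoc, mul_assoc (e _), mul_assoc (e _), h3, mul_smul_comm, smul_smul, smul_smul]
  congr 1
  rw [hp, zpow_add₀ hq', neg_mul_eq_mul_neg, neg_zpow_sg, zpow_natCast, mul_left_comm,
    ← zpow_add₀ hq]
  congr 2
  rw [Finset.sum_insert hrc, ← hh r hrM c hcM, ← Finset.add_sum_erase I h hcI]
  ring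

end aux3
end QG
namespace QG
section aux4
open Finset

/-- cyclic position of `y` starting from `α` -/
def cyc {n : ℕ} (α : ℕ) (y : Fin n) : ℕ :=
  if α % n ≤ y then y - α % n else y + n - α % n

lemma fmod_val {n : ℕ} (hn : 0 < n) (α : ℕ) {k : ℕ} (hk : k < n) :
    (fmod n hn (α + k)).val = if α % n + k < n then α % n + k else α % n + k - n := by
  have ha := Nat.mod_lt α hn
  change (α + k) % n = _
  rw [Nat.add_mod, Nat.mod_eq_of_lt hk]
  split_ifs with h
  · exact Nat.mod_eq_of_lt h
  · rw [Nat.mod_eq_sub_mod (by omega), Nat.mod_eq_of_lt (by omega)]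

lemma cyc_lt {n : ℕ} (α : ℕ) (y : Fin n) : cyc α y < n := by
  have := y.2
  have ha := Nat.mod_lt α (by omega : 0 < n)
  unfold cyc; split_ifs <;> omega

lemma cyc_fmod {n : ℕ} (hn : 0 < n) (α : ℕ) {k : ℕ} (hk : k < n) :
    cyc α (fmod n hn (α + k)) = k := by
  have ha := Nat.mod_lt α hn
  unfold cyc
  rw [fmod_val hn α hk]
  split_ifs <;> omega

lemma fmod_cyc {n : ℕ} (hn : 0 < n) (α : ℕ) (y : Fin n) : fmod n hn (α + cyc α y) = y := by
  apply Fin.ext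
  rw [fmod_val hn α (cyc_lt α y)]
  have ha := Nat.mod_lt α hn
  have := y.2
  unfold cyc
  split_ifs <;> omega

lemma cyc_inj {n : ℕ} (α : ℕ) {y z : Fin n} (h : cyc α y = cyc α z) : y = z := by
  have hn : 0 < n := by have := y.2; omega
  rw [← fmod_cyc hn α y, h, fmod_cyc]

lemma mem_consec {n : ℕ} (hn : 0 < n) {m : ℕ} (hmn : m < n) (α : ℕ) (y : Fin n) :
    y ∈ consecSet hn m α ↔ cyc α y < m := by
  unfold consecSet
  simp only [mem_image, mem_range]
  constructor
  · rintro ⟨k, hk, rfl⟩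
    rwa [cyc_fmod hn α (by omega)]
  · intro h
    exact ⟨_, h, fmod_cyc hn α y⟩

lemma card_consec {n : ℕ} (hn : 0 < n) {m : ℕ} (hmn : m < n) (α : ℕ) :
    (consecSet hn m α).card = m := by
  unfold consecSet
  rw [Finset.card_image_of_injOn, Finset.card_range]
  intro a ha b hb h
  simp at ha hb
  have := congrArg (cyc α) h
  simp only at this
  rwa [cyc_fmod hn α (by omega), cyc_fmod hn α (by omega)] at this

/-- the weight function for a cyclic interval -/
def wt {n : ℕ} (m α : ℕ) (y : Fin n) : ℤ :=
  if n < α % n + m then (if α % n ≤ y then 1 else if y + n < α % n + m then -1 else 0)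
  else (if (y : ℕ) < α % n then -1 else if y < α % n + m then 0 else 1)

lemma wt_isWt {n : ℕ} (hn : 0 < n) {m : ℕ} (hmn : m < n) (α : ℕ) :
    IsWt (consecSet hn m α) (wt m α) := by
  intro r hr c hc
  rw [mem_consec hn hmn] at hr hc
  have ha := Nat.mod_lt α hn
  have h1 := r.2
  have h2 := c.2
  unfold cyc at hr hc
  unfold wt sg
  simp only [Fin.lt_def]
  split_ifs at * <;> omega

/-- the element of `M_α` indexed by the row `i` -/
def rowElt {n : ℕ} (hn : 0 < n) (m α : ℕ) (i : Fin m) : Fin n := fmod n hn (α + (m - 1 - i))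

lemma cyc_rowElt {n : ℕ} (hn : 0 < n) {m : ℕ} (hmn : m < n) (α : ℕ) (i : Fin m) :
    cyc α (rowElt hn m α i) = m - 1 - i := cyc_fmod hn α (by omega)

lemma rowElt_inj {n : ℕ} (hn : 0 < n) {m : ℕ} (hmn : m < n) (α : ℕ) :
    Function.Injective (rowElt hn m α) := by
  intro i j h
  have := congrArg (cyc α) h
  rw [cyc_rowElt hn hmn, cyc_rowElt hn hmn] at this
  have h1 := i.2
  have h2 := j.2
  exact Fin.ext (by omega)

lemma mem_rowSet {n : ℕ} (hn : 0 < n) (m α : ℕ) (I : Finset (Fin n)) (i : Fin m) :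
    i ∈ rowSetOf hn m α I ↔ rowElt hn m α i ∉ I := by
  unfold rowSetOf rowElt
  simp only [mem_image, mem_filter, mem_univ, true_and]
  have e : ∀ k : Fin m, (m - 1 - (Fin.rev k : Fin m) : ℕ) = k := by
    intro k; rw [Fin.val_rev]; omega
  constructor
  · rintro ⟨k, hk, rfl⟩
    rwa [e]
  · intro h
    refine ⟨Fin.rev i, ?_, Fin.rev_rev i⟩
    rw [← e (Fin.rev i), Fin.rev_rev]
    exact h

lemma mem_colSet {n : ℕ} (hn : 0 < n) (m α : ℕ) (I : Finset (Fin n)) (d : Fin (n - m)) :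
    d ∈ colSetOf hn m α I ↔ fmod n hn (α + m + d) ∈ I := by
  simp [colSetOf]

lemma image_rowSet {n : ℕ} (hn : 0 < n) {m : ℕ} (hmn : m < n) (α : ℕ) (I : Finset (Fin n)) :
    (rowSetOf hn m α I).image (rowElt hn m α) = consecSet hn m α \ I := by
  ext y
  simp only [mem_image, mem_sdiff, mem_rowSet, mem_consec hn hmn]
  constructor
  · rintro ⟨i, hi, rfl⟩
    rw [cyc_rowElt hn hmn]
    have := i.2
    exact ⟨by omega, hi⟩
  · rintro ⟨h1, h2⟩
    have : rowElt hn m α ⟨m - 1 - cyc α y, by omega⟩ = y := by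
      apply cyc_inj α
      rw [cyc_rowElt hn hmn]
      simp only
      omega
    exact ⟨_, by rwa [this], this⟩

lemma cycnat {n : ℕ} (α : ℕ) (y : Fin n) :
    (α % n ≤ (y : ℕ) ∧ cyc α y + α % n = y) ∨
      ((y : ℕ) < α % n ∧ cyc α y + α % n = y + n) := by
  have h1 := Nat.mod_lt α y.pos
  have h2 := y.2
  unfold cyc; split_ifs <;> omega

lemma ite_sub_one {n m a r c y u v w : ℕ} (hr : r < n) (hc : c < n) (hy : y < n)
    (hyr : y ≠ r) (hu : u < m) (hv : v < m) (hw : m ≤ w)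
    (h1 : (a ≤ r ∧ u + a = r) ∨ (r < a ∧ u + a = r + n))
    (h2 : (a ≤ y ∧ v + a = y) ∨ (y < a ∧ v + a = y + n))
    (h3 : (a ≤ c ∧ w + a = c) ∨ (c < a ∧ w + a = c + n)) :
    (((if r < y then 1 else 0) - (if c < y then 1 else 0)) : ℤ) =
      (if u < v then 1 else 0) - (if c < r then 1 else 0) := by
  rcases h1 with h1 | h1 <;> rcases h2 with h2 | h2 <;> rcases h3 with h3 | h3 <;>
    split_ifs <;> omega

lemma ite_sub_two {n m a r c y u v w : ℕ} (hr : r < n) (hc : c < n) (hy : y < n)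
    (hyc : y ≠ c) (hu : u < m) (hv : w ≤ v) (hw : m ≤ w)
    (h1 : (a ≤ r ∧ u + a = r) ∨ (r < a ∧ u + a = r + n))
    (h2 : (a ≤ y ∧ v + a = y) ∨ (y < a ∧ v + a = y + n))
    (h3 : (a ≤ c ∧ w + a = c) ∨ (c < a ∧ w + a = c + n)) :
    (((if y < r then 1 else 0) - (if y < c then 1 else 0)) : ℤ) =
      (if c < r then 1 else 0) := by
  rcases h1 with h1 | h1 <;> rcases h2 with h2 | h2 <;> rcases h3 with h3 | h3 <;>
    split_ifs <;> omega

lemma cnt_cyc {n : ℕ} (hn : 0 < n) {m : ℕ} (hmn : m < n) (α : ℕ) {I : Finset (Fin n)}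
    (hI : I.card = m) {c : Fin n} (hcM : c ∉ consecSet hn m α) (hcI : c ∈ I)
    (hmin : ∀ y ∈ I, y ∉ consecSet hn m α → cyc α c ≤ cyc α y)
    {i : Fin m} (hi : i ∈ rowSetOf hn m α I) :
    (cnt (consecSet hn m α) I c (rowElt hn m α i) : ℤ) - cnt (consecSet hn m α) I c c =
      (((rowSetOf hn m α I).filter (· < i)).card : ℕ) + sg (rowElt hn m α i) c := by
  set M := consecSet hn m α with hMdef
  set r := rowElt hn m α i with hr
  have hrMI : r ∈ M \ I := by
    rw [hMdef, ← image_rowSet hn hmn]; exact Finset.mem_image_of_mem _ hi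
  obtain ⟨hrM, hrI⟩ := Finset.mem_sdiff.1 hrMI
  rw [cnt_eq hcM hcI hrM hrI]
  have ha := Nat.mod_lt α hn
  have hrc := (mem_consec hn hmn α r).1 hrM
  have hcc := mt (mem_consec hn hmn α c).2 hcM
  have hc2 := c.2
  have hr2 := r.2
  have s1 : ∀ y ∈ (M \ I).erase r, (((if r < y then 1 else 0) - (if c < y then 1 else 0)) : ℤ) =
      (if cyc α r < cyc α y then 1 else 0) - (if c < r then 1 else 0) := by
    intro y hy
    rw [mem_erase, mem_sdiff] at hy
    have hyM := (mem_consec hn hmn α y).1 hy.2.1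
    have hyr : (y : ℕ) ≠ r := fun h => hy.1 (Fin.ext h)
    have hy2 := y.2
    simp only [Fin.lt_def]
    exact ite_sub_one hr2 hc2 hy2 hyr hrc hyM (not_lt.1 hcc) (cycnat α r) (cycnat α y) (cycnat α c)
  have s2 : ∀ y ∈ (I \ M).erase c, (((if y < r then 1 else 0) - (if y < c then 1 else 0)) : ℤ) =
      (if c < r then 1 else 0) := by
    intro y hy
    rw [mem_erase, mem_sdiff] at hy
    have hyM := mt (mem_consec hn hmn α y).2 hy.2.2
    have hyc : (y : ℕ) ≠ c := fun h => hy.1 (Fin.ext h)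
    have hle := hmin y hy.2.1 hy.2.2
    have hy2 := y.2
    simp only [Fin.lt_def]
    exact ite_sub_two hr2 hc2 hy2 hyc hrc hle (not_lt.1 hcc) (cycnat α r) (cycnat α y) (cycnat α c)
  rw [Finset.sum_congr rfl s1, Finset.sum_congr rfl s2, Finset.sum_sub_distrib, Finset.sum_const,
    Finset.sum_const]
  have hcard : ((M \ I).erase r).card = ((I \ M).erase c).card := by
    rw [Finset.card_erase_of_mem hrMI, Finset.card_erase_of_mem (by simp [hcI, hcM]),
      Finset.card_sdiff_comm]
    rw [hI, hMdef, card_consec hn hmn]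
  rw [hcard]
  have hs : (∑ y ∈ (M \ I).erase r, (if cyc α r < cyc α y then 1 else 0) : ℤ) =
      (((rowSetOf hn m α I).filter (· < i)).card : ℕ) := by
    rw [← Finset.card_image_of_injective _ (rowElt_inj hn hmn α), Finset.sum_boole]
    congr 2
    ext y
    rw [hMdef, ← image_rowSet hn hmn]
    simp only [mem_filter, mem_erase, mem_image]
    constructor
    · rintro ⟨⟨h1, j, hj, rfl⟩, h2⟩
      rw [hr, cyc_rowElt hn hmn, cyc_rowElt hn hmn] at h2
      exact ⟨j, ⟨hj, by rw [Fin.lt_def]; omega⟩, rfl⟩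
    · rintro ⟨j, ⟨hj, hji⟩, rfl⟩
      refine ⟨⟨fun h => hji.ne (rowElt_inj hn hmn α h), j, hj, rfl⟩, ?_⟩
      rw [hr, cyc_rowElt hn hmn, cyc_rowElt hn hmn]
      have := i.2
      rw [Fin.lt_def] at hji
      omega
  rw [hs]
  simp only [sg]
  ring

lemma main_aux (K : Type*) [Field K] (q : K) (hq : q ≠ 0) (m n : ℕ) (hn : 0 < n) (hmn : m < n)
    (α : ℕ) (B : Type*) [Ring B] [Algebra K B]
    (L : NormalLoc K (↥(qGrass K q m n)) B (grE K q m (consecSet hn m α))) (t : ℕ) :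
    ∀ I : Finset (Fin n), I.card = m → (colSetOf hn m α I).card = t →
    L.emb (grE K q m I) =
      E q (xElt K q m n hn α L) (colSetOf hn m α I) (rowSetOf hn m α I) *
        L.emb (grE K q m (consecSet hn m α)) := by
  set e : Finset (Fin n) → B := fun J => L.emb (grE K q m J) with he
  have hPl : IsPl q e := fun S C => gr_pluecker hq L.emb S C
  have hU : IsUnit (e (consecSet hn m α)) := L.isUnit
  have hcol : ∀ (y : Fin n), y ∉ consecSet hn m α →
      ∃ d : Fin (n - m), fmod n hn (α + m + d) = y := by
    intro y hy
    rw [mem_consec hn hmn] at hy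
    have := cyc_lt α y
    refine ⟨⟨cyc α y - m, by omega⟩, ?_⟩
    have h2 : α + m + (cyc α y - m) = α + cyc α y := by omega
    simp only [h2, fmod_cyc]
  have hcolc : ∀ d : Fin (n - m), cyc α (fmod n hn (α + m + d)) = m + d := by
    intro d
    rw [add_assoc, cyc_fmod hn α (by omega)]
  induction t with
  | zero =>
    intro I hI h0
    rw [Finset.card_eq_zero] at h0
    have hIM : I = consecSet hn m α := by
      refine Finset.eq_of_subset_of_card_le ?_ (by rw [hI, card_consec hn hmn])
      intro y hy
      by_contra hyM
      obtain ⟨d, rfl⟩ := hcol y hyM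
      rw [← mem_colSet, h0] at hy
      simp at hy
    have hR : rowSetOf hn m α I = ∅ := by
      rw [← Finset.image_eq_empty (f := rowElt hn m α), image_rowSet hn hmn, hIM]; simp
    rw [h0, hR, E_empty, if_pos rfl, one_mul, hIM]
  | succ t ih =>
    intro I hI ht
    have hne : (colSetOf hn m α I).Nonempty := Finset.card_pos.1 (by omega)
    set d := (colSetOf hn m α I).min' hne with hd
    have hdm : d ∈ colSetOf hn m α I := Finset.min'_mem _ _
    set c := fmod n hn (α + m + d) with hc
    have hcI : c ∈ I := (mem_colSet hn m α I d).1 hdm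
    have hcM : c ∉ consecSet hn m α := by
      rw [mem_consec hn hmn, hcolc]; omega
    have hmin : ∀ y ∈ I, y ∉ consecSet hn m α → cyc α c ≤ cyc α y := by
      intro y hy hyM
      obtain ⟨d', rfl⟩ := hcol y hyM
      rw [hcolc, hcolc]
      have : d ≤ d' := Finset.min'_le _ _ ((mem_colSet hn m α I d').2 hy)
      rw [Fin.le_def] at this
      omega
    have hE : colSetOf hn m α I = insert d ((colSetOf hn m α I).erase d) :=
      (Finset.insert_erase hdm).symm
    have hlt : ∀ b ∈ (colSetOf hn m α I).erase d, d < b := by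
      intro b hb
      rw [Finset.mem_erase] at hb
      exact lt_of_le_of_ne (Finset.min'_le _ _ hb.2) hb.1.symm
    rw [hE, E_insert hlt, T, Finset.sum_mul]
    -- invert `rowElt`
    obtain ⟨g, hg⟩ : ∃ g : Fin n → Fin m, ∀ i, g (rowElt hn m α i) = i := by
      have hm : 0 < m := by
        rw [← hI]; exact Finset.card_pos.2 ⟨c, hcI⟩
      haveI : Nonempty (Fin m) := ⟨⟨0, hm⟩⟩
      exact ⟨Function.invFun (rowElt hn m α),
        Function.leftInverse_invFun (rowElt_inj hn hmn α)⟩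
    have hst := step hq hPl hU (wt_isWt hn hmn α) (I := I) (by rw [hI, card_consec hn hmn])
      hcM hcI (fun r => ((rowSetOf hn m α I).filter (· < g r)).card) (by
        intro r hr
        rw [← image_rowSet hn hmn, Finset.mem_image] at hr
        obtain ⟨i, hi, rfl⟩ := hr
        simp only [hg]
        exact cnt_cyc hn hmn α hI hcM hcI hmin hi)
    change e I = _
    rw [hst, ← image_rowSet hn hmn, Finset.sum_image (fun a _ b _ h => rowElt_inj hn hmn α h)]
    refine Finset.sum_congr rfl fun i hi => ?_
    have hiI := (mem_rowSet hn m α I i).1 hi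
    have hrM : rowElt hn m α i ∈ consecSet hn m α := by
      rw [mem_consec hn hmn, cyc_rowElt hn hmn]
      have := i.2
      omega
    have hrc : rowElt hn m α i ∉ I.erase c := by simp [hiI]
    have hcard : (insert (rowElt hn m α i) (I.erase c)).card = m := by
      rw [Finset.card_insert_of_notMem hrc, Finset.card_erase_of_mem hcI]
      have := Finset.card_pos.2 ⟨c, hcI⟩
      omega
    have hcs : colSetOf hn m α (insert (rowElt hn m α i) (I.erase c)) =
        (colSetOf hn m α I).erase d := by
      ext b
      rw [mem_colSet, Finset.mem_erase, mem_colSet, Finset.mem_insert, Finset.mem_erase]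
      have h1 : fmod n hn (α + m + b) ≠ rowElt hn m α i := by
        intro h
        have := congrArg (cyc α) h
        rw [hcolc, cyc_rowElt hn hmn] at this
        have := i.2
        omega
      have h2 : fmod n hn (α + m + b) = c ↔ b = d := by
        constructor
        · intro h
          have := congrArg (cyc α) h
          rw [hcolc, hcolc] at this
          exact Fin.ext (by omega)
        · rintro rfl; rfl
      simp only [h1, false_or, ne_eq, h2]
    have hrs : rowSetOf hn m α (insert (rowElt hn m α i) (I.erase c)) =
        (rowSetOf hn m α I).erase i := by
      ext b
      rw [mem_rowSet, Finset.mem_erase, mem_rowSet, Finset.mem_insert, Finset.mem_erase]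
      have h1 : rowElt hn m α b ≠ c := by
        intro h
        have := congrArg (cyc α) h
        rw [hcolc, cyc_rowElt hn hmn] at this
        have := b.2
        omega
      simp only [(rowElt_inj hn hmn α).eq_iff, h1, not_or, ne_eq, not_false_eq_true, true_and]
    have hih := ih (insert (rowElt hn m α i) (I.erase c)) hcard (by
      rw [hcs, Finset.card_erase_of_mem hdm]; omega)
    rw [hcs, hrs] at hih
    rw [smul_mul_assoc, mul_assoc (xElt K q m n hn α L i d), ← hih]
    simp only [hg]
    rfl

end aux4

/-- Under the dehomogenisation at the consecutive minor `M_α`, the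
image of a generating quantum minor `[I]` of `O_q(G(m,n))` is
`[(α+m) − (M_α∖I_r) | I_c − (α+m−1)]·y_α`, where `I_r = I ∩ M_α`, `I_c = I ∖ I_r`, and
the minor on the right is a quantum minor of the quantum matrix algebra `K[x_{ij}]`.
(Here the dehomogenisation is realised inside the localisation `B` itself, where
`y_α` is the image of `M_α`.) -/
theorem dehomogenisation_image_of_minor
    (K : Type*) [Field K] (q : K) (hq : q ≠ 0) (m n : ℕ) (hm : 0 < m) (hmn : m < n)
    (α : ℕ) (B : Type*) [Ring B] [Algebra K B]
    (L : NormalLoc K (↥(qGrass K q m n)) B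
      (grE K q m (consecSet (show 0 < n by omega) m α)))
    (I : Finset (Fin n)) (hI : I.card = m) :
    L.emb (grE K q m I) =
      finsetMinor K q (xElt K q m n (show 0 < n by omega) α L)
          (rowSetOf (show 0 < n by omega) m α I) (colSetOf (show 0 < n by omega) m α I) *
        L.emb (grE K q m (consecSet (show 0 < n by omega) m α)) := by
  rw [finsetMinor_eq]
  exact main_aux K q hq m n _ hmn α B L _ I hI rfl

end QG
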